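/- There exist positive constants l_1, …, l_n such that the discontinuous feedback u = v_n(x) = −l_n·sign(ω_n(x)) stabilizes the n-th integrator ẋ = J_n x + e_n u globally in finite time, in the following sense: for every locally absolutely continuous function x : [0,∞) → ℝ^n for which there exists a measurable function u : [0,∞) → [−l_n, l_n] with x'(t) = J_n x(t) + e_n u(t) for almost every t ≥ 0 and u(t) = −l_n·sign(ω_n(x(t))) whenever ω_n(x(t)) ≠ 0 (a Filippov solution of the closed loop), there exists T ≥ 0 with x(t) = 0 for all t ≥ T; moreover the origin is Lyapunov stable: for every ε > 0 there is δ > 0 such that every such solution with ‖x(0)‖ < δ satisfies ‖x(t)‖ < ε for all t ≥ 0. -/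

import Mathlib

open MeasureTheory Filter Matrix

noncomputable section

/-- The signed power `⌊x⌉^a = |x|^a · sign x`. -/
def sgnPow (x a : ℝ) : ℝ := |x| ^ a * Real.sign x

/-- The exponents `p_i = 1 - (i-1)/n`. -/
def pe (n i : ℕ) : ℝ := 1 - ((i : ℝ) - 1) / n

/-- The exponents `β_0 = p_2`, `β_i = (n-1+i)/(n-i)`. -/
def be (n i : ℕ) : ℝ := if i = 0 then pe n 2 else ((n : ℝ) - 1 + i) / ((n : ℝ) - i)

/-- The exponent `α = 2(n-1)/(2n-1)`. -/
def al (n : ℕ) : ℝ := 2 * ((n : ℝ) - 1) / (2 * (n : ℝ) - 1)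

/-- The recursively defined virtual controls `v_i`; states are 1-indexed sequences
(the 0-th coordinate is unused). -/
def vfb (n : ℕ) (l : ℕ → ℝ) : ℕ → (ℕ → ℝ) → ℝ
  | 0, _ => 0
  | i + 1, x =>
    -l (i + 1) *
      sgnPow (sgnPow (x (i + 1)) (be n i) - sgnPow (vfb n l i x) (be n i))
        (pe n (i + 2) / (pe n (i + 1) * be n i))

/-- `ω_i(x_1,…,x_i) = ⌊x_i⌉^{β_{i-1}} - ⌊v_{i-1}⌉^{β_{i-1}}`. -/
def omfb (n : ℕ) (l : ℕ → ℝ) (i : ℕ) (x : ℕ → ℝ) : ℝ :=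
  sgnPow (x i) (be n (i - 1)) - sgnPow (vfb n l (i - 1) x) (be n (i - 1))

/-- `W_i`. -/
def Wfb (n : ℕ) (l : ℕ → ℝ) (i : ℕ) (x : ℕ → ℝ) : ℝ :=
  (|x i| ^ (be n (i - 1) + 1) - |vfb n l (i - 1) x| ^ (be n (i - 1) + 1)) / (be n (i - 1) + 1) -
    sgnPow (vfb n l (i - 1) x) (be n (i - 1)) * (x i - vfb n l (i - 1) x)

/-- Embedding of `ℝ^n` into 1-indexed sequences. -/
def emb (n : ℕ) (x : Fin n → ℝ) (j : ℕ) : ℝ :=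
  if h : 1 ≤ j ∧ j ≤ n then x ⟨j - 1, by omega⟩ else 0

/-- The Lyapunov function `V_n = Σ_{i=1}^n W_i` on `ℝ^n`. -/
def Vn (n : ℕ) (l : ℕ → ℝ) (x : Fin n → ℝ) : ℝ :=
  ∑ i ∈ Finset.Icc 1 n, Wfb n l i (emb n x)

/-- `ω_n` on `ℝ^n`. -/
def omn (n : ℕ) (l : ℕ → ℝ) (x : Fin n → ℝ) : ℝ := omfb n l n (emb n x)

/-- The `n`-th Jordan block: `(J_n)_{ij} = 1` if `i = j - 1` (1-indexed), else `0`. -/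
def Jmat (n : ℕ) : Matrix (Fin n) (Fin n) ℝ :=
  Matrix.of fun i j => if (i : ℕ) + 1 = (j : ℕ) then 1 else 0

/-- The `i`-th standard basis vector of `ℝ^n` (1-indexed: `eVec n n = e_n`). -/
def eVec (n i : ℕ) : Fin n → ℝ := fun j => if (j : ℕ) + 1 = i then 1 else 0

/-- A Filippov solution of `ẋ = J_n x + e_n u`, `u = -l_n sign(ω_n(x))`:
`x` is locally absolutely continuous (expressed in integral form) with a measurable
control `u` taking values in `[-l_n, l_n]` which equals `-l_n sign(ω_n(x(t)))`
whenever `ω_n(x(t)) ≠ 0`. -/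
def IsFil0 (n : ℕ) (l : ℕ → ℝ) (x : ℝ → Fin n → ℝ) : Prop :=
  ∃ u : ℝ → ℝ, Measurable u ∧ (∀ t, 0 ≤ t → u t ∈ Set.Icc (-l n) (l n)) ∧
    (∀ t, 0 ≤ t → x t = x 0 + ∫ s in (0:ℝ)..t, ((Jmat n) *ᵥ x s + u s • eVec n n)) ∧
    ∀ t, 0 ≤ t → omn n l (x t) ≠ 0 → u t = -l n * Real.sign (omn n l (x t))

/-! ### Signed powers -/

lemma sgnPow_zero_left (b : ℝ) : sgnPow 0 b = 0 := by simp [sgnPow]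

lemma sgnPow_of_pos {x : ℝ} (hx : 0 < x) (b : ℝ) : sgnPow x b = x ^ b := by
  simp [sgnPow, Real.sign_of_pos hx, abs_of_pos hx]

lemma sgnPow_neg (x b : ℝ) : sgnPow (-x) b = -sgnPow x b := by
  simp [sgnPow, Real.sign_neg]

lemma sgnPow_one (x : ℝ) : sgnPow x 1 = x := by
  rcases lt_trichotomy x 0 with h | rfl | h
  · simp [sgnPow, Real.sign_of_neg h, abs_of_neg h]
  · exact sgnPow_zero_left 1
  · simp [sgnPow_of_pos h]

lemma sgnPow_sgnPow (x b c : ℝ) : sgnPow (sgnPow x b) c = sgnPow x (b * c) := by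
  have key : ∀ y : ℝ, 0 < y → sgnPow (sgnPow y b) c = sgnPow y (b * c) := fun y hy => by
    rw [sgnPow_of_pos hy, sgnPow_of_pos (Real.rpow_pos_of_pos hy b), sgnPow_of_pos hy,
      Real.rpow_mul hy.le]
  rcases lt_trichotomy x 0 with h | rfl | h
  · have := key (-x) (by linarith)
    simpa [sgnPow_neg] using this
  · simp [sgnPow_zero_left]
  · exact key x h

lemma sgnPow_eq_zero {x b : ℝ} : sgnPow x b = 0 ↔ x = 0 := by
  refine ⟨fun h => ?_, fun h => h ▸ sgnPow_zero_left b⟩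
  by_contra hx
  have h1 : |x| ^ b ≠ 0 := (Real.rpow_pos_of_pos (abs_pos.2 hx) b).ne'
  have h2 : Real.sign x ≠ 0 := by rwa [Ne, Real.sign_eq_zero_iff]
  exact mul_ne_zero h1 h2 h

lemma sgnPow_injective {b : ℝ} (hb : b ≠ 0) : Function.Injective (sgnPow · b) := fun x y h => by
  have := congrArg (sgnPow · b⁻¹) h
  simpa [sgnPow_sgnPow, hb, sgnPow_one] using this

lemma sgnPow_mul_of_pos {c : ℝ} (hc : 0 < c) (x b : ℝ) :
    sgnPow (c * x) b = c ^ b * sgnPow x b := by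
  rcases lt_trichotomy x 0 with h | rfl | h
  · simp [sgnPow, Real.sign_of_neg h, Real.sign_of_neg (mul_neg_of_pos_of_neg hc h), abs_mul,
      abs_of_pos hc, Real.mul_rpow hc.le (abs_nonneg x)]
  · simp [sgnPow_zero_left]
  · simp [sgnPow_of_pos h, sgnPow_of_pos (mul_pos hc h), Real.mul_rpow hc.le h.le]

lemma sgnPow_pow_mul {c : ℝ} (hc : 0 < c) {k m : ℕ} {b : ℝ} (hkb : (k : ℝ) * b = m) (x : ℝ) :
    sgnPow (c ^ k * x) b = c ^ m * sgnPow x b := by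
  rw [sgnPow_mul_of_pos (pow_pos hc k), ← Real.rpow_natCast, ← Real.rpow_mul hc.le, hkb,
    Real.rpow_natCast]

lemma abs_pow_mul_rpow {c : ℝ} (hc : 0 < c) {k m : ℕ} {b : ℝ} (hkb : (k : ℝ) * b = m) (x : ℝ) :
    |c ^ k * x| ^ b = c ^ m * |x| ^ b := by
  rw [abs_mul, abs_of_pos (pow_pos hc k), Real.mul_rpow (pow_pos hc k).le (abs_nonneg x),
    ← Real.rpow_natCast, ← Real.rpow_mul hc.le, hkb, Real.rpow_natCast]

lemma mul_sgnPow_self (x : ℝ) {b : ℝ} (hb : 0 ≤ b) : x * sgnPow x b = |x| ^ (1 + b) := by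
  rcases lt_trichotomy x 0 with h | rfl | h
  · rw [Real.rpow_add (abs_pos.2 h.ne), Real.rpow_one, sgnPow, Real.sign_of_neg h, abs_of_neg h]
    ring
  · rw [abs_zero, Real.zero_rpow (by linarith), zero_mul]
  · rw [Real.rpow_add (abs_pos.2 h.ne'), Real.rpow_one, sgnPow, Real.sign_of_pos h, abs_of_pos h]
    ring

lemma sgnPow_eq_mul (x : ℝ) (b : ℝ) : sgnPow x b = x * |x| ^ (b - 1) := by
  rcases lt_trichotomy x 0 with h | rfl | h
  · rw [Real.rpow_sub_one (abs_pos.2 h.ne).ne', sgnPow, Real.sign_of_neg h, abs_of_neg h]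
    have := h.ne
    field_simp
  · simp [sgnPow_zero_left]
  · rw [Real.rpow_sub_one (abs_pos.2 h.ne').ne', sgnPow, Real.sign_of_pos h, abs_of_pos h]
    field_simp

lemma continuous_sgnPow {b : ℝ} (hb : 0 < b) : Continuous (sgnPow · b) := by
  have h : (sgnPow · b) = fun x : ℝ => max x 0 ^ b - max (-x) 0 ^ b := by
    funext x
    rcases lt_trichotomy x 0 with h | rfl | h
    · rw [max_eq_right h.le, max_eq_left (by linarith), Real.zero_rpow hb.ne', sgnPow,
        Real.sign_of_neg h, abs_of_neg h]
      ring
    · simp [sgnPow_zero_left]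
    · rw [max_eq_left h.le, max_eq_right (by linarith), Real.zero_rpow hb.ne', sgnPow_of_pos h]
      ring
  rw [h]
  exact ((continuous_id.max continuous_const).rpow_const fun _ => Or.inr hb.le).sub
    ((continuous_neg.max continuous_const).rpow_const fun _ => Or.inr hb.le)

lemma continuous_abs_rpow {b : ℝ} (hb : 0 ≤ b) : Continuous fun x : ℝ => |x| ^ b :=
  continuous_abs.rpow_const fun _ => Or.inr hb

lemma hasDerivAt_sgnPow {b : ℝ} (hb : 1 < b) (x : ℝ) :
    HasDerivAt (sgnPow · b) (b * |x| ^ (b - 1)) x := by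
  have key : ∀ y : ℝ, 0 < y → HasDerivAt (sgnPow · b) (b * |y| ^ (b - 1)) y := fun y hy => by
    rw [abs_of_pos hy]
    refine (Real.hasDerivAt_rpow_const (Or.inr hb.le)).congr_of_eventuallyEq ?_
    filter_upwards [lt_mem_nhds hy] with z hz using sgnPow_of_pos hz b
  rcases lt_trichotomy x 0 with h | rfl | h
  · have h1 := key (-x) (by linarith)
    have h2 := (h1.comp x (hasDerivAt_neg x)).neg
    rw [abs_neg] at h2
    refine (h2.congr_deriv (by ring)).congr_of_eventuallyEq ?_
    exact Eventually.of_forall fun z => by simp [sgnPow_neg]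
  · rw [hasDerivAt_iff_tendsto_slope]
    have h1 : Tendsto (fun z : ℝ => |z| ^ (b - 1)) (nhdsWithin 0 {0}ᶜ)
        (nhds (b * |0| ^ (b - 1))) := by
      have := (continuous_abs_rpow (b := b - 1) (by linarith)).tendsto 0
      simp only [abs_zero, Real.zero_rpow (show b - 1 ≠ 0 by linarith), mul_zero] at this ⊢
      exact this.mono_left nhdsWithin_le_nhds
    refine h1.congr' ?_
    filter_upwards [self_mem_nhdsWithin] with z hz
    have hz : z ≠ 0 := hz
    rw [slope_def_field, sgnPow_zero_left, sgnPow_eq_mul]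
    field_simp
    simp
  · exact key x h

lemma hasDerivAt_abs_rpow_add_one {b : ℝ} (hb : 0 < b) (x : ℝ) :
    HasDerivAt (fun y : ℝ => |y| ^ (b + 1) / (b + 1)) (sgnPow x b) x := by
  refine ((hasDerivAt_abs_rpow x (by linarith : 1 < b + 1)).div_const (b + 1)).congr_deriv ?_
  rw [sgnPow_eq_mul, show b + 1 - 2 = b - 1 by ring]
  field_simp

/-! ### Exponents -/

lemma be_eq {n : ℕ} (hn : 0 < n) (i : ℕ) : be n i = ((n : ℝ) - 1 + i) / ((n : ℝ) - i) := by
  have : (n : ℝ) ≠ 0 := by positivity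
  rcases Nat.eq_zero_or_pos i with rfl | hi
  · simp only [be, pe, if_true, Nat.cast_zero, Nat.cast_ofNat, sub_zero, add_zero]
    field_simp
    ring
  · rw [be, if_neg hi.ne']

lemma be_pos {n i : ℕ} (hn : 2 ≤ n) (hi : i < n) : 0 < be n i := by
  rw [be_eq (by omega)]
  have h1 : (2 : ℝ) ≤ n := by exact_mod_cast hn
  have h2 : (i : ℝ) < n := by exact_mod_cast hi
  have h3 : (0 : ℝ) ≤ i := by positivity
  exact div_pos (by linarith) (by linarith)

lemma one_lt_be {n i : ℕ} (hn : 2 ≤ n) (h0 : 1 ≤ i) (hi : i < n) : 1 < be n i := by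
  rw [be_eq (by omega)]
  have h1 : (2 : ℝ) ≤ n := by exact_mod_cast hn
  have h2 : (i : ℝ) < n := by exact_mod_cast hi
  have h3 : (1 : ℝ) ≤ i := by exact_mod_cast h0
  rw [one_lt_div (by linarith)]
  linarith

/-- The exponent applied to `ω_{i+1}` in the definition of `v_{i+1}`. -/
def ctrlExp (n i : ℕ) : ℝ := pe n (i + 2) / (pe n (i + 1) * be n i)

/-- The exponent applied to `ω_{i+1}` in `⌊v_{i+1}⌉^{β_{i+1}}`. -/
def phiExp (n i : ℕ) : ℝ := ((n : ℝ) + i) / ((n : ℝ) - 1 + i)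

lemma ctrlExp_eq {n i : ℕ} (hn : 2 ≤ n) (hi : i < n) :
    ctrlExp n i = ((n : ℝ) - i - 1) / ((n : ℝ) - 1 + i) := by
  have h1 : (2 : ℝ) ≤ n := by exact_mod_cast hn
  have h2 : (i : ℝ) < n := by exact_mod_cast hi
  have h3 : (0 : ℝ) ≤ i := by positivity
  have h4 : (n : ℝ) ≠ 0 := by linarith
  have h5 : (n : ℝ) - i ≠ 0 := by linarith
  have h6 : (n : ℝ) - 1 + i ≠ 0 := by linarith
  have h7 : pe n (i + 1) = ((n : ℝ) - i) / n := by
    rw [pe]; push_cast; field_simp; ring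
  have h8 : pe n (i + 2) = ((n : ℝ) - i - 1) / n := by
    rw [pe]; push_cast; field_simp; ring
  rw [ctrlExp, h7, h8, be_eq (by omega)]
  field_simp

lemma ctrlExp_nonneg {n i : ℕ} (hn : 2 ≤ n) (hi : i < n) : 0 ≤ ctrlExp n i := by
  rw [ctrlExp_eq hn hi]
  have h1 : (2 : ℝ) ≤ n := by exact_mod_cast hn
  have h2 : (i : ℝ) + 1 ≤ n := by exact_mod_cast hi
  have h3 : (0 : ℝ) ≤ i := by positivity
  exact div_nonneg (by linarith) (by linarith)

lemma ctrlExp_pos {n i : ℕ} (hn : 2 ≤ n) (hi : i + 1 < n) : 0 < ctrlExp n i := by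
  rw [ctrlExp_eq hn (by omega)]
  have h1 : (2 : ℝ) ≤ n := by exact_mod_cast hn
  have h2 : (i : ℝ) + 1 < n := by exact_mod_cast hi
  have h3 : (0 : ℝ) ≤ i := by positivity
  exact div_pos (by linarith) (by linarith)

lemma ctrlExp_mul_be {n i : ℕ} (hn : 2 ≤ n) (hi : i + 1 < n) :
    ctrlExp n i * be n (i + 1) = phiExp n i := by
  have h1 : (2 : ℝ) ≤ n := by exact_mod_cast hn
  have h2 : (i : ℝ) + 1 < n := by exact_mod_cast hi
  have h3 : (0 : ℝ) ≤ i := by positivity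
  have h5 : (n : ℝ) - (i + 1) ≠ 0 := by linarith
  have h6 : (n : ℝ) - 1 + i ≠ 0 := by linarith
  rw [ctrlExp_eq hn (by omega), be_eq (by omega), phiExp]
  push_cast
  field_simp
  ring

lemma one_lt_phiExp {n : ℕ} (hn : 2 ≤ n) (i : ℕ) : 1 < phiExp n i := by
  have h1 : (2 : ℝ) ≤ n := by exact_mod_cast hn
  have h3 : (0 : ℝ) ≤ i := by positivity
  rw [phiExp, one_lt_div (by linarith)]
  linarith

/-! ### The Lyapunov function and its derivative along the chain of integrators -/

/-- `φ_i = -⌊v_i⌉^{β_i}`. -/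
def phi (n : ℕ) (l : ℕ → ℝ) (i : ℕ) (x : ℕ → ℝ) : ℝ := -sgnPow (vfb n l i x) (be n i)

/-- The derivative of `φ_i` along `ẋ_j = x_{j+1}`. -/
def dphi (n : ℕ) (l : ℕ → ℝ) : ℕ → (ℕ → ℝ) → ℝ
  | 0, _ => 0
  | 1, x => l 1 ^ be n 1 * x 2
  | i + 2, x => l (i + 2) ^ be n (i + 2) *
      (phiExp n (i + 1) * |omfb n l (i + 2) x| ^ (phiExp n (i + 1) - 1) *
        (be n (i + 1) * |x (i + 2)| ^ (be n (i + 1) - 1) * x (i + 3) + dphi n l (i + 1) x))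

/-- `ω_i`, with the convention `ω_0 = 0`. -/
def omz (n : ℕ) (l : ℕ → ℝ) : ℕ → (ℕ → ℝ) → ℝ
  | 0, _ => 0
  | i + 1, x => omfb n l (i + 1) x

/-- The part of the decay rate at level `i + 1` which does not involve the gain `l_{i+1}`. -/
def crossTerm (n : ℕ) (l : ℕ → ℝ) (i : ℕ) (x : ℕ → ℝ) : ℝ :=
  (omz n l i x + dphi n l i x) * (x (i + 1) - vfb n l i x)

/-- The derivative of `W_1 + ⋯ + W_i` along `ẋ_j = x_{j+1}` when `x_{i+1} = v_i`. -/
def rate (n : ℕ) (l : ℕ → ℝ) : ℕ → (ℕ → ℝ) → ℝ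
  | 0, _ => 0
  | i + 1, x => rate n l i x + crossTerm n l i x
      - l (i + 1) * |omfb n l (i + 1) x| ^ (1 + ctrlExp n i)

/-- The function `W_{i+1}`, written in terms of `φ_i`. -/
def wfun (n : ℕ) (l : ℕ → ℝ) (i : ℕ) (x : ℕ → ℝ) : ℝ :=
  |x (i + 1)| ^ (be n i + 1) / (be n i + 1) + phi n l i x * x (i + 1) +
    |phi n l i x| ^ ((be n i)⁻¹ + 1) / ((be n i)⁻¹ + 1)

/-- The partial sums `W_1 + ⋯ + W_i`. -/
def lyap (n : ℕ) (l : ℕ → ℝ) (i : ℕ) (x : ℕ → ℝ) : ℝ := ∑ j ∈ Finset.range i, wfun n l j x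

lemma vfb_succ (n : ℕ) (l : ℕ → ℝ) (i : ℕ) (x : ℕ → ℝ) :
    vfb n l (i + 1) x = -l (i + 1) * sgnPow (omfb n l (i + 1) x) (ctrlExp n i) := rfl

lemma omfb_succ (n : ℕ) (l : ℕ → ℝ) (i : ℕ) (x : ℕ → ℝ) :
    omfb n l (i + 1) x = sgnPow (x (i + 1)) (be n i) + phi n l i x := by
  simp [omfb, phi, sub_eq_add_neg]

lemma phi_zero (n : ℕ) (l : ℕ → ℝ) (x : ℕ → ℝ) : phi n l 0 x = 0 := by
  simp [phi, vfb, sgnPow_zero_left]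

lemma phi_succ {n i : ℕ} (hn : 2 ≤ n) {l : ℕ → ℝ} (hl : ∀ j, 0 < l j) (hi : i + 1 < n)
    (x : ℕ → ℝ) :
    phi n l (i + 1) x = l (i + 1) ^ be n (i + 1) * sgnPow (omfb n l (i + 1) x) (phiExp n i) := by
  rw [phi, vfb_succ, neg_mul, sgnPow_neg, neg_neg, sgnPow_mul_of_pos (hl _), sgnPow_sgnPow,
    ctrlExp_mul_be hn hi]

lemma phi_one {n : ℕ} (hn : 2 ≤ n) {l : ℕ → ℝ} (hl : ∀ j, 0 < l j) (x : ℕ → ℝ) :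
    phi n l 1 x = l 1 ^ be n 1 * x 1 := by
  have h1 : (2 : ℝ) ≤ n := by exact_mod_cast hn
  have h6 : (n : ℝ) - 1 ≠ 0 := by linarith
  have : be n 0 * phiExp n 0 = 1 := by
    rw [be_eq (by omega), phiExp]
    push_cast
    simp only [add_zero, sub_zero]
    field_simp
  rw [phi_succ hn hl (by omega), omfb_succ, phi_zero, add_zero, sgnPow_sgnPow, this, sgnPow_one]

lemma vfb_eq_phi {n i : ℕ} (hn : 2 ≤ n) (l : ℕ → ℝ) (hi : i < n) (x : ℕ → ℝ) :
    vfb n l i x = -sgnPow (phi n l i x) (be n i)⁻¹ := by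
  rw [phi, sgnPow_neg, neg_neg, sgnPow_sgnPow, mul_inv_cancel₀ (be_pos hn hi).ne', sgnPow_one]

lemma omfb_mul_vfb {n i : ℕ} (hn : 2 ≤ n) (l : ℕ → ℝ) (hi : i < n) (x : ℕ → ℝ) :
    omfb n l (i + 1) x * vfb n l (i + 1) x =
      -(l (i + 1) * |omfb n l (i + 1) x| ^ (1 + ctrlExp n i)) := by
  rw [vfb_succ, ← mul_sgnPow_self _ (ctrlExp_nonneg hn hi)]
  ring

/-! ### Continuity -/

lemma continuous_vfb {n i : ℕ} (hn : 2 ≤ n) (l : ℕ → ℝ) (hi : i < n) :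
    Continuous (vfb n l i) := by
  induction i with
  | zero => exact continuous_const
  | succ i ih =>
    have hb := be_pos hn (show i < n by omega)
    exact continuous_const.mul ((continuous_sgnPow (ctrlExp_pos hn hi)).comp
      (((continuous_sgnPow hb).comp (continuous_apply (i + 1))).sub
        ((continuous_sgnPow hb).comp (ih (by omega)))))

lemma continuous_phi {n i : ℕ} (hn : 2 ≤ n) (l : ℕ → ℝ) (hi : i < n) :
    Continuous (phi n l i) :=
  ((continuous_sgnPow (be_pos hn hi)).comp (continuous_vfb hn l hi)).neg

lemma continuous_omfb {n i : ℕ} (hn : 2 ≤ n) (l : ℕ → ℝ) (hi : i < n) :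
    Continuous (omfb n l (i + 1)) := by
  rw [funext (omfb_succ n l i)]
  exact ((continuous_sgnPow (be_pos hn hi)).comp (continuous_apply (i + 1))).add
    (continuous_phi hn l hi)

lemma continuous_dphi {n i : ℕ} (hn : 2 ≤ n) (l : ℕ → ℝ) (hi : i < n) :
    Continuous (dphi n l i) := by
  induction i with
  | zero => exact continuous_const
  | succ i ih =>
    rcases i with _ | i
    · exact continuous_const.mul (continuous_apply 2)
    · have h1 := one_lt_phiExp hn (i + 1)
      have h2 := one_lt_be hn (show 1 ≤ i + 1 by omega) (show i + 1 < n by omega)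
      have h3 := (continuous_abs_rpow (sub_nonneg.2 h1.le)).comp
        (continuous_omfb hn l (show i + 1 < n by omega))
      have h4 := (continuous_abs_rpow (sub_nonneg.2 h2.le)).comp
        (continuous_apply (A := fun _ : ℕ => ℝ) (i + 2))
      have h5 := ih (by omega)
      have h6 := continuous_apply (A := fun _ : ℕ => ℝ) (i + 3)
      exact continuous_const.mul ((continuous_const.mul h3).mul
        (((continuous_const.mul h4).mul h6).add h5))

lemma continuous_crossTerm {n i : ℕ} (hn : 2 ≤ n) (l : ℕ → ℝ) (hi : i < n) :
    Continuous (crossTerm n l i) := by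
  have h : Continuous (omz n l i) := by
    rcases i with _ | i
    · exact continuous_const
    · exact continuous_omfb hn l (by omega)
  exact (h.add (continuous_dphi hn l hi)).mul
    ((continuous_apply (i + 1)).sub (continuous_vfb hn l hi))

lemma continuous_dampingTerm {n i : ℕ} (hn : 2 ≤ n) (l : ℕ → ℝ) (hi : i < n) :
    Continuous fun x => |omfb n l (i + 1) x| ^ (1 + ctrlExp n i) :=
  (continuous_abs_rpow (by linarith [ctrlExp_nonneg hn hi])).comp (continuous_omfb hn l hi)

lemma continuous_rate {n i : ℕ} (hn : 2 ≤ n) (l : ℕ → ℝ) (hi : i ≤ n) :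
    Continuous (rate n l i) := by
  induction i with
  | zero => exact continuous_const
  | succ i ih =>
    exact ((ih (by omega)).add (continuous_crossTerm hn l hi)).sub
      (continuous_const.mul (continuous_dampingTerm hn l hi))

lemma continuous_lyap {n i : ℕ} (hn : 2 ≤ n) (l : ℕ → ℝ) (hi : i ≤ n) :
    Continuous (lyap n l i) := by
  refine continuous_finsetSum _ fun j hj => ?_
  have hj : j < n := by have := Finset.mem_range.1 hj; omega
  have hb := be_pos hn hj
  have hb' := inv_pos.2 hb
  have h1 := (continuous_abs_rpow (b := be n j + 1) (by linarith)).comp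
    (continuous_apply (A := fun _ : ℕ => ℝ) (j + 1))
  have h2 := (continuous_abs_rpow (b := (be n j)⁻¹ + 1) (by linarith)).comp
    (continuous_phi hn l hj)
  exact ((h1.div_const _).add ((continuous_phi hn l hj).mul (continuous_apply (j + 1)))).add
    (h2.div_const _)

/-! ### Homogeneity -/

/-- `y` agrees on the coordinates `1, …, i` with the weighted dilation of `x` by `c`. -/
def IsDilate (n i : ℕ) (c : ℝ) (x y : ℕ → ℝ) : Prop :=
  ∀ j, 1 ≤ j → j ≤ i → y j = c ^ (n + 1 - j) * x j

lemma IsDilate.mono {n i i' : ℕ} {c : ℝ} {x y : ℕ → ℝ} (h : IsDilate n i c x y) (hi : i' ≤ i) :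
    IsDilate n i' c x y := fun j h1 h2 => h j h1 (h2.trans hi)

lemma weight_mul_be {n i : ℕ} (hn : 2 ≤ n) (hi : i < n) :
    ((n - i : ℕ) : ℝ) * be n i = ((n - 1 + i : ℕ) : ℝ) := by
  have h2 : (i : ℝ) < n := by exact_mod_cast hi
  have h5 : (n : ℝ) - i ≠ 0 := by linarith
  rw [be_eq (by omega), Nat.cast_sub hi.le, Nat.cast_add, Nat.cast_sub (by omega), Nat.cast_one]
  field_simp

lemma weight_mul_ctrlExp {n i : ℕ} (hn : 2 ≤ n) (hi : i < n) :
    ((n - 1 + i : ℕ) : ℝ) * ctrlExp n i = ((n - (i + 1) : ℕ) : ℝ) := by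
  have h1 : (2 : ℝ) ≤ n := by exact_mod_cast hn
  have h3 : (0 : ℝ) ≤ i := by positivity
  have h6 : (n : ℝ) - 1 + i ≠ 0 := by linarith
  rw [ctrlExp_eq hn hi, Nat.cast_add, Nat.cast_sub (by omega), Nat.cast_sub (by omega)]
  push_cast
  field_simp
  ring

lemma vfb_dilate {n i : ℕ} (hn : 2 ≤ n) (l : ℕ → ℝ) (hi : i < n) {c : ℝ} (hc : 0 < c)
    {x y : ℕ → ℝ} (h : IsDilate n i c x y) : vfb n l i y = c ^ (n - i) * vfb n l i x := by
  induction i with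
  | zero => simp [vfb]
  | succ i ih =>
    have hi' : i < n := by omega
    have h0 : y (i + 1) = c ^ (n - i) * x (i + 1) := by
      rw [h (i + 1) (by omega) le_rfl]; congr 2; omega
    have hb := weight_mul_be hn hi'
    have : omfb n l (i + 1) y = c ^ (n - 1 + i) * omfb n l (i + 1) x := by
      simp only [omfb, Nat.add_sub_cancel]
      rw [h0, ih hi' (h.mono (by omega)), sgnPow_pow_mul hc hb, sgnPow_pow_mul hc hb]
      ring
    rw [vfb_succ, vfb_succ, this, sgnPow_pow_mul hc (weight_mul_ctrlExp hn hi')]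
    ring

lemma phi_dilate {n i : ℕ} (hn : 2 ≤ n) (l : ℕ → ℝ) (hi : i < n) {c : ℝ} (hc : 0 < c)
    {x y : ℕ → ℝ} (h : IsDilate n i c x y) : phi n l i y = c ^ (n - 1 + i) * phi n l i x := by
  rw [phi, phi, vfb_dilate hn l hi hc h, sgnPow_pow_mul hc (weight_mul_be hn hi)]
  ring

lemma IsDilate.apply_succ {n i : ℕ} {c : ℝ} {x y : ℕ → ℝ} (h : IsDilate n (i + 1) c x y) :
    y (i + 1) = c ^ (n - i) * x (i + 1) := by
  rw [h (i + 1) (by omega) le_rfl]; congr 2; omega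

lemma omfb_dilate {n i : ℕ} (hn : 2 ≤ n) (l : ℕ → ℝ) (hi : i < n) {c : ℝ} (hc : 0 < c)
    {x y : ℕ → ℝ} (h : IsDilate n (i + 1) c x y) :
    omfb n l (i + 1) y = c ^ (n - 1 + i) * omfb n l (i + 1) x := by
  rw [omfb_succ, omfb_succ, h.apply_succ, phi_dilate hn l hi hc (h.mono (by omega)),
    sgnPow_pow_mul hc (weight_mul_be hn hi)]
  ring

lemma dphi_dilate {n i : ℕ} (hn : 2 ≤ n) (l : ℕ → ℝ) (hi : i < n) {c : ℝ} (hc : 0 < c)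
    {x y : ℕ → ℝ} (h : IsDilate n (i + 1) c x y) :
    dphi n l i y = c ^ (n - 2 + i) * dphi n l i x := by
  induction i with
  | zero => simp [dphi]
  | succ i ih =>
    rcases i with _ | i
    · rw [dphi, dphi, h.apply_succ, show n - 2 + (0 + 1) = n - (0 + 1) by omega]
      ring
    · have e1 : ((n - 1 + (i + 1) : ℕ) : ℝ) * (phiExp n (i + 1) - 1) = ((1 : ℕ) : ℝ) := by
        have h1 : (2 : ℝ) ≤ n := by exact_mod_cast hn
        have h3 : (0 : ℝ) ≤ i := by positivity
        have h6 : (n : ℝ) - 1 + (i + 1) ≠ 0 := by linarith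
        rw [phiExp, Nat.cast_add, Nat.cast_sub (by omega)]
        push_cast
        field_simp
        ring
      have e2 : ((n - (i + 1) : ℕ) : ℝ) * (be n (i + 1) - 1) = ((2 * i + 1 : ℕ) : ℝ) := by
        rw [mul_sub, weight_mul_be hn (by omega), Nat.cast_add (n - 1), Nat.cast_sub (by omega),
          Nat.cast_sub (by omega)]
        push_cast
        ring
      rw [dphi, dphi, ih (by omega) (h.mono (by omega)),
        omfb_dilate hn l (show i + 1 < n by omega) hc (h.mono (by omega)),
        h.apply_succ, (h.mono (show i + 1 + 1 ≤ i + 1 + 1 + 1 by omega)).apply_succ,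
        abs_pow_mul_rpow hc e1, abs_pow_mul_rpow hc e2,
        show n - 2 + (i + 1 + 1) = 1 + (n - 2 + (i + 1)) by omega, pow_add c 1]
      have e4 : c ^ (n - 2 + (i + 1)) = c ^ (2 * i + 1) * c ^ (n - (i + 1 + 1)) := by
        rw [← pow_add]; congr 1; omega
      rw [e4]
      ring

lemma crossTerm_dilate {n i : ℕ} (hn : 2 ≤ n) (l : ℕ → ℝ) (hi : i < n) {c : ℝ} (hc : 0 < c)
    {x y : ℕ → ℝ} (h : IsDilate n (i + 1) c x y) :
    crossTerm n l i y = c ^ (2 * n - 2) * crossTerm n l i x := by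
  have h1 : omz n l i y = c ^ (n - 2 + i) * omz n l i x := by
    rcases i with _ | i
    · simp [omz]
    · rw [omz, omz, omfb_dilate hn l (by omega) hc (h.mono (by omega))]
      congr 2
      omega
  rw [crossTerm, crossTerm, h1, dphi_dilate hn l hi hc h, h.apply_succ,
    vfb_dilate hn l hi hc (h.mono (by omega)),
    show 2 * n - 2 = (n - 2 + i) + (n - i) by omega, pow_add]
  ring

lemma dampingTerm_dilate {n i : ℕ} (hn : 2 ≤ n) (l : ℕ → ℝ) (hi : i < n) {c : ℝ} (hc : 0 < c)
    {x y : ℕ → ℝ} (h : IsDilate n (i + 1) c x y) :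
    |omfb n l (i + 1) y| ^ (1 + ctrlExp n i) =
      c ^ (2 * n - 2) * |omfb n l (i + 1) x| ^ (1 + ctrlExp n i) := by
  rw [omfb_dilate hn l hi hc h, abs_pow_mul_rpow hc]
  rw [mul_add, mul_one, weight_mul_ctrlExp hn hi, ← Nat.cast_add]
  congr 1
  omega

lemma rate_dilate {n i : ℕ} (hn : 2 ≤ n) (l : ℕ → ℝ) (hi : i ≤ n) {c : ℝ} (hc : 0 < c)
    {x y : ℕ → ℝ} (h : IsDilate n i c x y) : rate n l i y = c ^ (2 * n - 2) * rate n l i x := by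
  induction i with
  | zero => simp [rate]
  | succ i ih =>
    rw [rate, rate, ih (by omega) (h.mono (by omega)), crossTerm_dilate hn l hi hc h,
      dampingTerm_dilate hn l hi hc h]
    ring

lemma lyap_dilate {n i : ℕ} (hn : 2 ≤ n) (l : ℕ → ℝ) (hi : i ≤ n) {c : ℝ} (hc : 0 < c)
    {x y : ℕ → ℝ} (h : IsDilate n i c x y) : lyap n l i y = c ^ (2 * n - 1) * lyap n l i x := by
  rw [lyap, lyap, Finset.mul_sum]
  refine Finset.sum_congr rfl fun j hj => ?_
  have hj := Finset.mem_range.1 hj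
  have hjn : j < n := by omega
  have hb := weight_mul_be hn hjn
  have e1 : ((n - j : ℕ) : ℝ) * (be n j + 1) = ((2 * n - 1 : ℕ) : ℝ) := by
    rw [mul_add, hb, mul_one, ← Nat.cast_add]; congr 1; omega
  have e2 : ((n - 1 + j : ℕ) : ℝ) * ((be n j)⁻¹ + 1) = ((2 * n - 1 : ℕ) : ℝ) := by
    rw [mul_add, mul_one, ← hb, mul_inv_cancel_right₀ (be_pos hn hjn).ne', hb, ← Nat.cast_add]
    congr 1; omega
  rw [wfun, wfun, (h.mono (show j + 1 ≤ i by omega)).apply_succ,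
    phi_dilate hn l hjn hc (h.mono (by omega)), abs_pow_mul_rpow hc e1, abs_pow_mul_rpow hc e2,
    show 2 * n - 1 = (n - 1 + j) + (n - j) by omega, pow_add]
  ring

/-! ### Dependence on the gains -/

lemma vfb_congr_gain {n i : ℕ} {l l' : ℕ → ℝ} (h : ∀ j, j ≤ i → l j = l' j) :
    vfb n l i = vfb n l' i := by
  induction i with
  | zero => rfl
  | succ i ih =>
    funext x
    rw [vfb, vfb, ih fun j hj => h j (by omega), h (i + 1) le_rfl]

lemma omfb_congr_gain {n i : ℕ} {l l' : ℕ → ℝ} (h : ∀ j, j ≤ i → l j = l' j) :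
    omfb n l (i + 1) = omfb n l' (i + 1) := by
  funext x
  rw [omfb, omfb, Nat.add_sub_cancel, vfb_congr_gain h]

lemma dphi_congr_gain {n i : ℕ} {l l' : ℕ → ℝ} (h : ∀ j, j ≤ i → l j = l' j) :
    dphi n l i = dphi n l' i := by
  induction i with
  | zero => rfl
  | succ i ih =>
    funext x
    rcases i with _ | i
    · rw [dphi, dphi, h 1 le_rfl]
    · rw [dphi, dphi, ih fun j hj => h j (by omega), h (i + 2) le_rfl,
        omfb_congr_gain fun j hj => h j (by omega)]

lemma crossTerm_congr_gain {n i : ℕ} {l l' : ℕ → ℝ} (h : ∀ j, j ≤ i → l j = l' j) :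
    crossTerm n l i = crossTerm n l' i := by
  funext x
  have : omz n l i = omz n l' i := by
    rcases i with _ | i
    · rfl
    · exact omfb_congr_gain fun j hj => h j (by omega)
  rw [crossTerm, crossTerm, this, dphi_congr_gain h, vfb_congr_gain h]

lemma rate_congr_gain {n i : ℕ} {l l' : ℕ → ℝ} (h : ∀ j, j ≤ i → l j = l' j) :
    rate n l i = rate n l' i := by
  induction i with
  | zero => rfl
  | succ i ih =>
    have h' : ∀ j, j ≤ i → l j = l' j := fun j hj => h j (by omega)
    funext x
    rw [rate, rate, ih h', crossTerm_congr_gain h', omfb_congr_gain h', h (i + 1) le_rfl]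

/-! ### Compactness of the homogeneous unit sphere -/

/-- A homogeneous norm for the weighted dilations of the coordinates `1, …, i`. -/
def homNorm (n i : ℕ) (x : ℕ → ℝ) : ℝ :=
  ∑ j ∈ Finset.Icc 1 i, |x j| ^ (((n + 1 - j : ℕ) : ℝ)⁻¹)

/-- The unit sphere of the homogeneous norm, inside sequences supported in `1, …, i`. -/
def homSphere (n i : ℕ) : Set (ℕ → ℝ) :=
  {x | (∀ j, ¬(1 ≤ j ∧ j ≤ i) → x j = 0) ∧ homNorm n i x = 1}

lemma continuous_homNorm (n i : ℕ) : Continuous (homNorm n i) :=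
  continuous_finsetSum _ fun j _ =>
    (continuous_abs_rpow (inv_nonneg.2 (Nat.cast_nonneg _))).comp (continuous_apply j)

lemma isCompact_homSphere {n i : ℕ} (hi : i ≤ n) : IsCompact (homSphere n i) := by
  have hK : IsCompact (Set.pi Set.univ fun _ : ℕ => Set.Icc (-1 : ℝ) 1) :=
    isCompact_univ_pi fun _ => isCompact_Icc
  refine hK.of_isClosed_subset ?_ fun x hx j _ => ?_
  · have h1 : IsClosed {x : ℕ → ℝ | ∀ j, ¬(1 ≤ j ∧ j ≤ i) → x j = 0} := by
      simp only [Set.ofPred_forall]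
      exact isClosed_iInter fun j => isClosed_iInter fun _ =>
        isClosed_eq (continuous_apply j) continuous_const
    exact h1.inter (isClosed_eq (continuous_homNorm n i) continuous_const)
  · refine abs_le.1 ?_
    by_cases hj : 1 ≤ j ∧ j ≤ i
    · have hle : |x j| ^ (((n + 1 - j : ℕ) : ℝ)⁻¹) ≤ 1 := by
        rw [← hx.2]
        exact Finset.single_le_sum
          (f := fun j => |x j| ^ (((n + 1 - j : ℕ) : ℝ)⁻¹))
          (fun k _ => Real.rpow_nonneg (abs_nonneg _) _) (Finset.mem_Icc.2 hj)
      by_contra! hlt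
      have hpos : (0 : ℝ) < (((n + 1 - j : ℕ) : ℝ)⁻¹) := by
        have : 0 < n + 1 - j := by omega
        positivity
      exact absurd hle (not_le.2 (Real.one_lt_rpow hlt hpos))
    · rw [hx.1 j hj]
      simp

lemma homNorm_pos {n i : ℕ} {x : ℕ → ℝ} (hx : ∃ j, 1 ≤ j ∧ j ≤ i ∧ x j ≠ 0) :
    0 < homNorm n i x := by
  obtain ⟨j, h1, h2, h3⟩ := hx
  exact Finset.sum_pos' (fun k _ => Real.rpow_nonneg (abs_nonneg _) _)
    ⟨j, Finset.mem_Icc.2 ⟨h1, h2⟩, Real.rpow_pos_of_pos (abs_pos.2 h3) _⟩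

lemma exists_ne_zero_of_mem_homSphere {n i : ℕ} (hi : i ≤ n) {x : ℕ → ℝ}
    (hx : x ∈ homSphere n i) : ∃ j, 1 ≤ j ∧ j ≤ i ∧ x j ≠ 0 := by
  by_contra! h
  have : homNorm n i x = 0 := Finset.sum_eq_zero fun j hj => by
    have hj := Finset.mem_Icc.1 hj
    have : ((n + 1 - j : ℕ) : ℝ) ≠ 0 := by
      have : n + 1 - j ≠ 0 := by omega
      exact_mod_cast this
    rw [h j hj.1 hj.2, abs_zero, Real.zero_rpow (inv_ne_zero this)]
  rw [hx.2] at this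
  exact one_ne_zero this

lemma exists_dilate_mem_homSphere {n i : ℕ} (hi : i ≤ n) {x : ℕ → ℝ}
    (hx : ∃ j, 1 ≤ j ∧ j ≤ i ∧ x j ≠ 0) :
    ∃ c, 0 < c ∧ ∃ y ∈ homSphere n i, IsDilate n i c x y := by
  have hN := homNorm_pos (n := n) hx
  have hc := inv_pos.2 hN
  set c := (homNorm n i x)⁻¹ with hc_def
  refine ⟨c, hc, fun j => if 1 ≤ j ∧ j ≤ i then c ^ (n + 1 - j) * x j else 0,
    ⟨fun j hj => if_neg hj, ?_⟩, fun j h1 h2 => if_pos ⟨h1, h2⟩⟩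
  have : ∀ j ∈ Finset.Icc 1 i,
      |if 1 ≤ j ∧ j ≤ i then c ^ (n + 1 - j) * x j else 0| ^ (((n + 1 - j : ℕ) : ℝ)⁻¹) =
        c * |x j| ^ (((n + 1 - j : ℕ) : ℝ)⁻¹) := fun j hj => by
    have hj := Finset.mem_Icc.1 hj
    have hk : ((n + 1 - j : ℕ) : ℝ) ≠ 0 := by
      have : n + 1 - j ≠ 0 := by omega
      exact_mod_cast this
    rw [if_pos hj, abs_pow_mul_rpow hc (m := 1) (by rw [mul_inv_cancel₀ hk, Nat.cast_one]),
      pow_one]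
  rw [homNorm, Finset.sum_congr rfl this, ← Finset.mul_sum]
  exact inv_mul_cancel₀ hN.ne'

lemma exists_gain_of_isCompact {X : Type*} [TopologicalSpace X] {K : Set X} (hK : IsCompact K)
    {f g : X → ℝ} (hf : Continuous f) (hg : Continuous g) (hg0 : ∀ x, 0 ≤ g x)
    (hfg : ∀ x ∈ K, g x = 0 → f x < 0) : ∃ k : ℝ, 0 < k ∧ ∀ x ∈ K, f x - k * g x < 0 := by
  let U : ℕ → Set X := fun k => {x | f x - ((k : ℝ) + 1) * g x < 0}
  have hU : ∀ k, IsOpen (U k) := fun k =>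
    isOpen_lt (hf.sub (continuous_const.mul hg)) continuous_const
  have hcov : K ⊆ ⋃ k, U k := fun x hx => by
    rw [Set.mem_iUnion]
    rcases (hg0 x).eq_or_lt with h | h
    · refine ⟨0, ?_⟩
      have := hfg x hx h.symm
      simpa [U, ← h] using this
    · obtain ⟨k, hk⟩ := exists_nat_gt (f x / g x)
      refine ⟨k, ?_⟩
      rw [div_lt_iff₀ h] at hk
      change f x - ((k : ℝ) + 1) * g x < 0
      nlinarith
  have hmono : Monotone U := fun a b hab x (hx : f x - ((a : ℝ) + 1) * g x < 0) => by
    change f x - ((b : ℝ) + 1) * g x < 0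
    have : (a : ℝ) ≤ b := by exact_mod_cast hab
    nlinarith [hg0 x]
  obtain ⟨k, hk⟩ := hK.elim_directed_cover U hU hcov hmono.directed_le
  exact ⟨k + 1, by positivity, fun x hx => hk hx⟩

/-! ### Choice of the gains -/

lemma vfb_eq_zero {n i : ℕ} (l : ℕ → ℝ) {x : ℕ → ℝ} (h : ∀ j, 1 ≤ j → j ≤ i → x j = 0) :
    vfb n l i x = 0 := by
  induction i with
  | zero => rfl
  | succ i ih =>
    rw [vfb, ih fun j h1 h2 => h j h1 (by omega), h (i + 1) (by omega) le_rfl]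
    simp [sgnPow_zero_left]

lemma eq_vfb_of_omfb_eq_zero {n i : ℕ} (hn : 2 ≤ n) (l : ℕ → ℝ) (hi : i < n) {x : ℕ → ℝ}
    (h : omfb n l (i + 1) x = 0) : x (i + 1) = vfb n l i x := by
  rw [omfb, Nat.add_sub_cancel, sub_eq_zero] at h
  exact sgnPow_injective (be_pos hn hi).ne' h

lemma exists_gains_rate_neg {n : ℕ} (hn : 2 ≤ n) (i : ℕ) (hi : i ≤ n) :
    ∃ l : ℕ → ℝ, (∀ j, 0 < l j) ∧
      ∀ x : ℕ → ℝ, (∃ j, 1 ≤ j ∧ j ≤ i ∧ x j ≠ 0) → rate n l i x < 0 := by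
  induction i with
  | zero => exact ⟨fun _ => 1, fun _ => one_pos, fun x ⟨j, h1, h2, _⟩ => by omega⟩
  | succ i ih =>
    obtain ⟨l, hl, hrate⟩ := ih (by omega)
    obtain ⟨k, hk, hneg⟩ := exists_gain_of_isCompact (isCompact_homSphere hi)
      (f := fun x => rate n l i x + crossTerm n l i x)
      ((continuous_rate hn l (by omega)).add (continuous_crossTerm hn l hi))
      (continuous_dampingTerm hn l hi)
      (fun x => Real.rpow_nonneg (abs_nonneg _) _) (fun x hx h0 => by
        have hexp : 1 + ctrlExp n i ≠ 0 := by linarith [ctrlExp_nonneg hn hi]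
        rw [Real.rpow_eq_zero (abs_nonneg _) hexp, abs_eq_zero] at h0
        have hv := eq_vfb_of_omfb_eq_zero hn l hi h0
        rw [crossTerm, hv, sub_self, mul_zero, add_zero]
        refine hrate x ?_
        by_contra! hzero
        obtain ⟨j, h1, h2, h3⟩ := exists_ne_zero_of_mem_homSphere hi hx
        rcases h2.lt_or_eq with h2 | rfl
        · exact h3 (hzero j h1 (by omega))
        · exact h3 (hv.trans (vfb_eq_zero l hzero)))
    refine ⟨Function.update l (i + 1) k, fun j => ?_, fun x hx => ?_⟩
    · by_cases hj : j = i + 1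
      · simpa [hj] using hk
      · simpa [hj] using hl j
    · obtain ⟨c, hc, y, hy, hxy⟩ := exists_dilate_mem_homSphere hi hx
      have hcongr : ∀ j, j ≤ i → Function.update l (i + 1) k j = l j := fun j hj =>
        Function.update_of_ne (by omega) _ _
      have h1 := hneg y hy
      have h2 : rate n (Function.update l (i + 1) k) (i + 1) y < 0 := by
        rw [rate, rate_congr_gain hcongr, crossTerm_congr_gain hcongr, omfb_congr_gain hcongr,
          Function.update_self]
        exact h1
      rw [rate_dilate hn _ hi hc hxy] at h2
      by_contra! h3
      exact absurd h2 (not_lt.2 (mul_nonneg (by positivity) h3))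

/-! ### Positive definiteness and decay of the Lyapunov function -/

lemma wfun_nonneg {n i : ℕ} (hn : 2 ≤ n) (l : ℕ → ℝ) (hi : i < n) (x : ℕ → ℝ) :
    0 ≤ wfun n l i x := by
  have hb := be_pos hn hi
  have hpq : (be n i + 1).HolderConjugate ((be n i)⁻¹ + 1) := by
    rw [Real.holderConjugate_iff]
    refine ⟨by linarith, ?_⟩
    field_simp
    ring
  have := Real.young_inequality (-x (i + 1)) (phi n l i x) hpq
  rw [abs_neg] at this
  rw [wfun]
  nlinarith

lemma omfb_eq_zero_of_wfun_eq_zero {n i : ℕ} (hn : 2 ≤ n) (l : ℕ → ℝ) (hi : i < n) {x : ℕ → ℝ}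
    (h : wfun n l i x = 0) : omfb n l (i + 1) x = 0 := by
  let f : ℝ → ℝ := fun z => |z| ^ (be n i + 1) / (be n i + 1) + phi n l i x * z +
    |phi n l i x| ^ ((be n i)⁻¹ + 1) / ((be n i)⁻¹ + 1)
  have hcoord : ∀ z, f z = wfun n l i (Function.update x (i + 1) z) := fun z => by
    have hd : IsDilate n i 1 x (Function.update x (i + 1) z) := fun j _ h2 => by
      rw [Function.update_of_ne (by omega), one_pow, one_mul]
    have hphi := phi_dilate hn l hi one_pos hd
    rw [one_pow, one_mul] at hphi
    rw [wfun, hphi, Function.update_self]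
  have hmin : IsLocalMin f (x (i + 1)) := Eventually.of_forall fun z => by
    have h0 : f (x (i + 1)) = 0 := h
    rw [h0, hcoord]
    exact wfun_nonneg hn l hi _
  have hder : HasDerivAt f (sgnPow (x (i + 1)) (be n i) + phi n l i x * 1) (x (i + 1)) :=
    ((hasDerivAt_abs_rpow_add_one (be_pos hn hi) _).add
      ((hasDerivAt_id _).const_mul _)).add_const _
  rw [omfb_succ, ← mul_one (phi n l i x)]
  exact hmin.hasDerivAt_eq_zero hder

lemma lyap_nonneg {n : ℕ} (hn : 2 ≤ n) (l : ℕ → ℝ) (x : ℕ → ℝ) : 0 ≤ lyap n l n x :=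
  Finset.sum_nonneg fun _ hj => wfun_nonneg hn l (Finset.mem_range.1 hj) x

lemma eq_zero_of_lyap_eq_zero {n : ℕ} (hn : 2 ≤ n) (l : ℕ → ℝ) {x : ℕ → ℝ}
    (h : lyap n l n x = 0) (j : ℕ) (h1 : 1 ≤ j) (hj : j ≤ n) : x j = 0 := by
  rw [lyap, Finset.sum_eq_zero_iff_of_nonneg
    fun _ hj => wfun_nonneg hn l (Finset.mem_range.1 hj) x] at h
  induction j using Nat.strong_induction_on with
  | _ j ih =>
    obtain ⟨i, rfl⟩ : ∃ i, j = i + 1 := ⟨j - 1, by omega⟩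
    rw [eq_vfb_of_omfb_eq_zero hn l hj
      (omfb_eq_zero_of_wfun_eq_zero hn l hj (h i (Finset.mem_range.2 hj)))]
    exact vfb_eq_zero l fun k h1 h2 => ih k (by omega) h1 (by omega)

lemma lyap_pos {n : ℕ} (hn : 2 ≤ n) (l : ℕ → ℝ) {x : ℕ → ℝ}
    (hx : ∃ j, 1 ≤ j ∧ j ≤ n ∧ x j ≠ 0) : 0 < lyap n l n x := by
  refine (lyap_nonneg hn l x).lt_of_ne fun h => ?_
  obtain ⟨j, h1, h2, h3⟩ := hx
  exact h3 (eq_zero_of_lyap_eq_zero hn l h.symm j h1 h2)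

lemma lyap_eq_zero {n : ℕ} (hn : 2 ≤ n) (l : ℕ → ℝ) {x : ℕ → ℝ}
    (hx : ∀ j, 1 ≤ j → j ≤ n → x j = 0) : lyap n l n x = 0 := by
  refine Finset.sum_eq_zero fun j hj => ?_
  have hj := Finset.mem_range.1 hj
  have hb := be_pos hn hj
  have hb' := inv_pos.2 hb
  rw [wfun, phi, vfb_eq_zero l fun k h1 h2 => hx k h1 (by omega), hx (j + 1) (by omega) hj,
    sgnPow_zero_left]
  simp [Real.zero_rpow (show be n j + 1 ≠ 0 by linarith),
    Real.zero_rpow (show (be n j)⁻¹ + 1 ≠ 0 by linarith)]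

/-- The decay rate of `V^{1/(2n-1)}` is homogeneous of degree `0`, hence bounded away from `0`. -/
lemma exists_decay_rate {n : ℕ} (hn : 2 ≤ n) {l : ℕ → ℝ}
    (hrate : ∀ x : ℕ → ℝ, (∃ j, 1 ≤ j ∧ j ≤ n ∧ x j ≠ 0) → rate n l n x < 0) :
    ∃ k : ℝ, 0 < k ∧ ∀ x : ℕ → ℝ, (∃ j, 1 ≤ j ∧ j ≤ n ∧ x j ≠ 0) →
      rate n l n x * ((2 * n - 1 : ℕ) : ℝ)⁻¹ *
        lyap n l n x ^ (((2 * n - 1 : ℕ) : ℝ)⁻¹ - 1) ≤ -k := by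
  set m : ℝ := ((2 * n - 1 : ℕ) : ℝ) with hm_def
  have hm : 0 < m := by
    have : 0 < 2 * n - 1 := by omega
    rw [hm_def]; exact_mod_cast this
  let f : (ℕ → ℝ) → ℝ := fun x => -(rate n l n x * m⁻¹ * lyap n l n x ^ (m⁻¹ - 1))
  have hfpos : ∀ x, (∃ j, 1 ≤ j ∧ j ≤ n ∧ x j ≠ 0) → 0 < f x := fun x hx => by
    have h1 := hrate x hx
    have h2 := Real.rpow_pos_of_pos (lyap_pos hn l hx) (m⁻¹ - 1)
    have h3 := mul_pos (mul_pos (neg_pos.2 h1) (inv_pos.2 hm)) h2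
    simp only [f]
    linarith
  have hcont : ContinuousOn f (homSphere n n) := by
    refine (((continuous_rate hn l le_rfl).mul continuous_const).continuousOn.mul ?_).neg
    exact (continuous_lyap hn l le_rfl).continuousOn.rpow_const fun x hx =>
      Or.inl (lyap_pos hn l (exists_ne_zero_of_mem_homSphere le_rfl hx)).ne'
  have hinv : ∀ x y c, 0 < c → IsDilate n n c x y → f y = f x := fun x y c hc h => by
    have e : (c ^ (2 * n - 1)) ^ (m⁻¹ - 1) * c ^ (2 * n - 2) = 1 := by
      rw [← Real.rpow_natCast, ← Real.rpow_mul hc.le, ← Real.rpow_natCast, ← Real.rpow_add hc,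
        ← hm_def, mul_sub, mul_inv_cancel₀ hm.ne', mul_one, hm_def, Nat.cast_sub (by omega),
        Nat.cast_sub (by omega)]
      push_cast
      rw [show 1 - (2 * (n : ℝ) - 1) + (2 * n - 2) = 0 by ring, Real.rpow_zero]
    simp only [f]
    rw [rate_dilate hn l le_rfl hc h, lyap_dilate hn l le_rfl hc h,
      Real.mul_rpow (by positivity) (lyap_nonneg hn l x)]
    linear_combination (-(rate n l n x * m⁻¹ * lyap n l n x ^ (m⁻¹ - 1))) * e
  have hne : (homSphere n n).Nonempty := by
    obtain ⟨_, _, y, hy, _⟩ := exists_dilate_mem_homSphere (n := n) le_rfl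
      (x := fun _ => 1) ⟨1, le_rfl, by omega, one_ne_zero⟩
    exact ⟨y, hy⟩
  obtain ⟨z, hz, hmin⟩ := (isCompact_homSphere le_rfl).exists_isMinOn hne hcont
  refine ⟨f z, hfpos z (exists_ne_zero_of_mem_homSphere le_rfl hz), fun x hx => ?_⟩
  obtain ⟨c, hc, y, hy, hxy⟩ := exists_dilate_mem_homSphere le_rfl hx
  have h1 : f z ≤ f y := hmin hy
  rw [hinv x y c hc hxy] at h1
  simp only [f] at h1 ⊢
  linarith

/-! ### Derivatives along trajectories -/

lemma hasDerivAt_phi {n i : ℕ} (hn : 2 ≤ n) {l : ℕ → ℝ} (hl : ∀ j, 0 < l j) (hi : i < n)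
    {X : ℝ → ℕ → ℝ} {t : ℝ}
    (hX : ∀ j, 1 ≤ j → j ≤ i → HasDerivAt (fun s => X s j) (X t (j + 1)) t) :
    HasDerivAt (fun s => phi n l i (X s)) (dphi n l i (X t)) t := by
  induction i with
  | zero =>
    simp only [phi_zero]
    exact hasDerivAt_const t 0
  | succ i ih =>
    rcases i with _ | i
    · simp only [phi_one hn hl, Nat.zero_add]
      exact (hX 1 le_rfl le_rfl).const_mul _
    · have h1 := ih (by omega) fun j h1 h2 => hX j h1 (by omega)
      have h2 := (hasDerivAt_sgnPow (one_lt_be hn (show 1 ≤ i + 1 by omega)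
        (show i + 1 < n by omega)) (X t (i + 2))).comp t (hX (i + 2) (by omega) le_rfl)
      have h3 := h2.add h1
      have h4 : HasDerivAt (fun s => omfb n l (i + 2) (X s))
          (be n (i + 1) * |X t (i + 2)| ^ (be n (i + 1) - 1) * X t (i + 3) +
            dphi n l (i + 1) (X t)) t :=
        h3.congr_of_eventuallyEq (Eventually.of_forall fun s => omfb_succ n l (i + 1) (X s))
      have h5 := ((hasDerivAt_sgnPow (one_lt_phiExp hn (i + 1))
        (omfb n l (i + 2) (X t))).comp t h4).const_mul (l (i + 2) ^ be n (i + 2))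
      exact h5.congr_of_eventuallyEq (Eventually.of_forall fun s => phi_succ hn hl hi (X s))

lemma hasDerivAt_wfun {n i : ℕ} (hn : 2 ≤ n) {l : ℕ → ℝ} (hl : ∀ j, 0 < l j) (hi : i < n)
    {X : ℝ → ℕ → ℝ} {t d : ℝ}
    (hX : ∀ j, 1 ≤ j → j ≤ i → HasDerivAt (fun s => X s j) (X t (j + 1)) t)
    (hd : HasDerivAt (fun s => X s (i + 1)) d t) :
    HasDerivAt (fun s => wfun n l i (X s))
      (omfb n l (i + 1) (X t) * d + dphi n l i (X t) * (X t (i + 1) - vfb n l i (X t))) t := by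
  have hb := be_pos hn hi
  have hphi := hasDerivAt_phi hn hl hi hX
  have h1 := (hasDerivAt_abs_rpow_add_one hb (X t (i + 1))).comp t hd
  have h2 := (hasDerivAt_abs_rpow_add_one (inv_pos.2 hb) (phi n l i (X t))).comp t hphi
  refine ((h1.add (hphi.mul hd)).add h2).congr_deriv ?_
  rw [omfb_succ, vfb_eq_phi hn l hi]
  ring

/-- A product rule where one factor vanishes and the other one is only continuous. -/
lemma hasDerivAt_mul_of_eq_zero {f g : ℝ → ℝ} {t f' : ℝ} (hf : HasDerivAt f f' t)
    (hft : f t = 0) (hg : ContinuousAt g t) :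
    HasDerivAt (fun s => f s * g s) (f' * g t) t := by
  rw [hasDerivAt_iff_tendsto_slope] at hf ⊢
  refine (hf.mul (hg.tendsto.mono_left nhdsWithin_le_nhds)).congr fun s => ?_
  simp only [slope_def_field, hft]
  ring

/-- The chain rule at a critical point of the outer function, for an inner function which is only
Lipschitz at the base point. -/
lemma hasDerivAt_comp_of_deriv_eq_zero {f g : ℝ → ℝ} {t : ℝ} (hf : HasDerivAt f 0 (g t))
    (hg : (fun s => g s - g t) =O[nhds t] fun s => s - t) :
    HasDerivAt (fun s => f (g s)) 0 t := by
  have hgc : Tendsto g (nhds t) (nhds (g t)) := by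
    have h0 : Tendsto (fun s : ℝ => s - t) (nhds t) (nhds 0) :=
      (continuous_sub_right t).tendsto' t 0 (sub_self t)
    simpa using (hg.trans_tendsto h0).add_const (g t)
  rw [hasDerivAt_iff_isLittleO] at hf ⊢
  simpa [Function.comp_def] using (hf.comp_tendsto hgc).trans_isBigO hg

lemma hasDerivAt_wfun_of_omfb_eq_zero {n i : ℕ} (hn : 2 ≤ n) {l : ℕ → ℝ} (hl : ∀ j, 0 < l j)
    (hi : i < n) {X : ℝ → ℕ → ℝ} {t : ℝ}
    (hX : ∀ j, 1 ≤ j → j ≤ i → HasDerivAt (fun s => X s j) (X t (j + 1)) t)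
    (hLip : (fun s => X s (i + 1) - X t (i + 1)) =O[nhds t] fun s => s - t)
    (hcont : ContinuousAt (fun s => X s (i + 1)) t) (h0 : omfb n l (i + 1) (X t) = 0) :
    HasDerivAt (fun s => wfun n l i (X s))
      (dphi n l i (X t) * (X t (i + 1) - vfb n l i (X t))) t := by
  have hb := be_pos hn hi
  have hphi := hasDerivAt_phi hn hl hi hX
  rw [omfb_succ] at h0
  have h1 : HasDerivAt (fun z => |z| ^ (be n i + 1) / (be n i + 1) + phi n l i (X t) * z) 0
      (X t (i + 1)) := by
    refine ((hasDerivAt_abs_rpow_add_one hb (X t (i + 1))).add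
      ((hasDerivAt_id _).const_mul (phi n l i (X t)))).congr_deriv ?_
    rw [mul_one, h0]
  have h2 := hasDerivAt_comp_of_deriv_eq_zero (g := fun s => X s (i + 1)) h1 hLip
  have h3 := hasDerivAt_mul_of_eq_zero (hphi.sub_const (phi n l i (X t))) (sub_self _) hcont
  have h4 := (hasDerivAt_abs_rpow_add_one (inv_pos.2 hb) (phi n l i (X t))).comp t hphi
  refine (((h2.add h3).add h4).congr_deriv ?_).congr_of_eventuallyEq
    (Eventually.of_forall fun s => ?_)
  · rw [vfb_eq_phi hn l hi]
    ring
  · simp only [wfun, Function.comp_def, Pi.add_apply]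
    ring

lemma hasDerivAt_lyap {n i : ℕ} (hn : 2 ≤ n) {l : ℕ → ℝ} (hl : ∀ j, 0 < l j) (hi : i < n)
    {X : ℝ → ℕ → ℝ} {t : ℝ}
    (hX : ∀ j, 1 ≤ j → j ≤ i → HasDerivAt (fun s => X s j) (X t (j + 1)) t) :
    HasDerivAt (fun s => lyap n l i (X s))
      (rate n l i (X t) + omz n l i (X t) * (X t (i + 1) - vfb n l i (X t))) t := by
  induction i with
  | zero =>
    simp only [lyap, Finset.range_zero, Finset.sum_empty, rate, omz, zero_mul, add_zero]
    exact hasDerivAt_const t 0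
  | succ i ih =>
    have h1 := ih (by omega) fun j h1 h2 => hX j h1 (by omega)
    have h2 := hasDerivAt_wfun hn hl (show i < n by omega) (fun j h1 h2 => hX j h1 (by omega))
      (hX (i + 1) (by omega) le_rfl)
    simp only [lyap, Finset.sum_range_succ] at h1 ⊢
    refine (h1.add h2).congr_deriv ?_
    have h3 := omfb_mul_vfb hn l (show i < n by omega) (X t)
    rw [rate, crossTerm]
    simp only [omz]
    linear_combination h3

/-- At the last level the input `x_n` need not be differentiable where `ω_n` vanishes. -/
lemma hasDerivAt_lyap_last {m : ℕ} (hn : 2 ≤ m + 1) {l : ℕ → ℝ} (hl : ∀ j, 0 < l j)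
    {X : ℝ → ℕ → ℝ} {t : ℝ}
    (hX : ∀ j, 1 ≤ j → j ≤ m → HasDerivAt (fun s => X s j) (X t (j + 1)) t)
    (hLip : (fun s => X s (m + 1) - X t (m + 1)) =O[nhds t] fun s => s - t)
    (hcont : ContinuousAt (fun s => X s (m + 1)) t)
    (hd : omfb (m + 1) l (m + 1) (X t) ≠ 0 → HasDerivAt (fun s => X s (m + 1))
      (-l (m + 1) * Real.sign (omfb (m + 1) l (m + 1) (X t))) t) :
    HasDerivAt (fun s => lyap (m + 1) l (m + 1) (X s)) (rate (m + 1) l (m + 1) (X t)) t := by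
  have h1 := hasDerivAt_lyap hn hl (show m < m + 1 by omega) hX
  have hexp : ctrlExp (m + 1) m = 0 := by
    rw [ctrlExp_eq hn (by omega)]
    push_cast
    simp
  have h2 : HasDerivAt (fun s => wfun (m + 1) l m (X s))
      (-(l (m + 1) * |omfb (m + 1) l (m + 1) (X t)|) +
        dphi (m + 1) l m (X t) * (X t (m + 1) - vfb (m + 1) l m (X t))) t := by
    by_cases h0 : omfb (m + 1) l (m + 1) (X t) = 0
    · refine (hasDerivAt_wfun_of_omfb_eq_zero hn hl (by omega) hX hLip hcont h0).congr_deriv ?_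
      rw [h0]
      simp
    · refine (hasDerivAt_wfun hn hl (by omega) hX (hd h0)).congr_deriv ?_
      have : omfb (m + 1) l (m + 1) (X t) * Real.sign (omfb (m + 1) l (m + 1) (X t)) =
          |omfb (m + 1) l (m + 1) (X t)| := by
        have := mul_sgnPow_self (omfb (m + 1) l (m + 1) (X t)) le_rfl
        simpa [sgnPow] using this
      linear_combination (-l (m + 1)) * this
  simp only [lyap, Finset.sum_range_succ] at h1 ⊢
  refine (h1.add h2).congr_deriv ?_
  rw [rate, crossTerm, hexp, add_zero, Real.rpow_one]
  ring

/-! ### A scalar finite-time convergence criterion -/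

lemma le_sub_mul_of_hasDerivAt {φ : ℝ → ℝ} {a b k : ℝ} (hab : a ≤ b)
    (hc : ContinuousOn φ (Set.Icc a b))
    (hd : ∀ t ∈ Set.Ioo a b, ∃ d, d ≤ -k ∧ HasDerivAt φ d t) :
    φ b ≤ φ a - k * (b - a) := by
  have h := Convex.image_sub_le_mul_sub_of_deriv_le (convex_Icc a b) hc
    (fun t ht => by
      rw [interior_Icc] at ht
      obtain ⟨d, _, h⟩ := hd t ht
      exact h.differentiableAt.differentiableWithinAt)
    (C := -k) (fun t ht => by
      rw [interior_Icc] at ht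
      obtain ⟨d, hdk, h⟩ := hd t ht
      rwa [h.deriv])
    a (Set.left_mem_Icc.2 hab) b (Set.right_mem_Icc.2 hab) hab
  linarith

lemma le_sub_mul_of_pos {φ : ℝ → ℝ} {k : ℝ} (hk : 0 < k) (hc : ContinuousOn φ (Set.Ici 0))
    (hd : ∀ t, 0 < t → 0 < φ t → ∃ d, d ≤ -k ∧ HasDerivAt φ d t)
    {t : ℝ} (ht : 0 ≤ t) (hpos : 0 < φ t) : φ t ≤ φ 0 - k * t := by
  have hall : ∀ s, 0 ≤ s → s ≤ t → 0 < φ s := by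
    by_contra! hcon
    obtain ⟨s, hs0, hst, hs⟩ := hcon
    have hcs : ContinuousOn φ (Set.Icc s t) := hc.mono fun r hr => hs0.trans hr.1
    let Z : Set ℝ := Set.Icc s t ∩ φ ⁻¹' Set.Iic 0
    have hZ : IsCompact Z :=
      isCompact_Icc.of_isClosed_subset (hcs.preimage_isClosed_of_isClosed isClosed_Icc isClosed_Iic)
        Set.inter_subset_left
    obtain ⟨r, hr, hmax⟩ := hZ.exists_isGreatest ⟨s, ⟨le_rfl, hst⟩, hs⟩
    have hr0 : φ r ≤ 0 := hr.2
    have hrt : r < t := lt_of_le_of_ne hr.1.2 fun h => absurd hpos (not_lt.2 (h ▸ hr0))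
    have := le_sub_mul_of_hasDerivAt hrt.le (hcs.mono (Set.Icc_subset_Icc_left hr.1.1))
      (k := k) fun q hq => hd q (lt_of_le_of_lt (hs0.trans hr.1.1) hq.1) (by
        by_contra! hq0
        exact absurd (hmax ⟨⟨hr.1.1.trans hq.1.le, hq.2.le⟩, hq0⟩) (not_le.2 hq.1))
    nlinarith
  have := le_sub_mul_of_hasDerivAt ht (hc.mono fun r hr => hr.1)
    (k := k) fun q hq => hd q hq.1 (hall q hq.1.le hq.2.le)
  simpa using this

/-- Lyapunov stability from a continuous positive definite function which does not exceed its
initial value. -/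
lemma exists_stability_radius {E : Type*} [NormedAddCommGroup E] [ProperSpace E] {V : E → ℝ}
    (hV : Continuous V) (hV0 : V 0 = 0) (hpos : ∀ v, v ≠ 0 → 0 < V v) {ε : ℝ} (hε : 0 < ε) :
    ∃ δ : ℝ, 0 < δ ∧ ∀ x : ℝ → E, ContinuousOn x (Set.Ici 0) →
      (∀ t, 0 ≤ t → V (x t) ≤ V (x 0)) → ‖x 0‖ < δ → ∀ t, 0 ≤ t → ‖x t‖ < ε := by
  obtain ⟨m, hm, hle⟩ : ∃ m, 0 < m ∧ ∀ v ∈ Metric.sphere (0 : E) ε, m ≤ V v := by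
    rcases (Metric.sphere (0 : E) ε).eq_empty_or_nonempty with h | h
    · exact ⟨1, one_pos, fun v hv => by simp [h] at hv⟩
    · obtain ⟨v, hv, hmin⟩ := (isCompact_sphere (0 : E) ε).exists_isMinOn h hV.continuousOn
      exact ⟨V v, hpos v (by rintro rfl; simp [hε.ne] at hv), fun w hw => hmin hw⟩
  have hnear : ∀ᶠ v in nhds (0 : E), V v < m := hV.tendsto 0 |>.eventually_lt_const (hV0 ▸ hm)
  obtain ⟨δ, hδ, hball⟩ := Metric.eventually_nhds_iff.1 hnear
  refine ⟨min δ ε, lt_min hδ hε, fun x hx hmono hx0 t ht => ?_⟩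
  by_contra! hcon
  have h0 : ‖x 0‖ ≤ ε := (hx0.trans_le (min_le_right _ _)).le
  obtain ⟨s, hs, hsε⟩ := intermediate_value_Icc ht
    ((hx.mono fun r hr => hr.1).norm : ContinuousOn (fun r => ‖x r‖) (Set.Icc 0 t)) ⟨h0, hcon⟩
  have h1 := hle (x s) (by simpa using hsε)
  have h2 := hmono s hs.1
  have h3 : V (x 0) < m := hball (by simpa using hx0.trans_le (min_le_left _ _))
  linarith

/-! ### Regularity of Filippov solutions -/

lemma emb_apply {n j : ℕ} (v : Fin n → ℝ) (h1 : 1 ≤ j) (h2 : j ≤ n) :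
    emb n v j = v ⟨j - 1, by omega⟩ := dif_pos ⟨h1, h2⟩

lemma continuous_emb (n : ℕ) : Continuous (emb n) := by
  refine continuous_pi fun j => ?_
  by_cases h : 1 ≤ j ∧ j ≤ n
  · simp only [emb, dif_pos h]
    exact continuous_apply _
  · simp only [emb, dif_neg h]
    exact continuous_const

lemma exists_emb_ne_zero {n : ℕ} {v : Fin n → ℝ} (hv : v ≠ 0) :
    ∃ j, 1 ≤ j ∧ j ≤ n ∧ emb n v j ≠ 0 := by
  obtain ⟨i, hi⟩ := Function.ne_iff.1 hv
  refine ⟨i + 1, by omega, i.2, ?_⟩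
  rw [emb_apply v (by omega) i.2]
  simpa using hi

/-- The `j`-th component of the right-hand side of the closed loop. -/
def loopField (n : ℕ) (u : ℝ → ℝ) (x : ℝ → Fin n → ℝ) (j : ℕ) (s : ℝ) : ℝ :=
  if j = n then u s else emb n (x s) (j + 1)

lemma Jmat_mulVec_add_apply (n : ℕ) (u : ℝ → ℝ) (x : ℝ → Fin n → ℝ) (s : ℝ) (i : Fin n) :
    ((Jmat n) *ᵥ x s + u s • eVec n n) i = loopField n u x (i + 1) s := by
  simp only [Pi.add_apply, Pi.smul_apply, smul_eq_mul, eVec, loopField, Matrix.mulVec, dotProduct,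
    Jmat, Matrix.of_apply, ite_mul, one_mul, zero_mul]
  by_cases h : (i : ℕ) + 1 = n
  · rw [if_pos h, if_pos h, mul_one, Finset.sum_eq_zero, zero_add]
    intro j _
    rw [if_neg]
    omega
  · have hi : (i : ℕ) + 1 < n := by omega
    rw [if_neg h, if_neg h, mul_zero, add_zero, emb_apply _ (by omega) (by omega),
      Finset.sum_eq_single (⟨(i : ℕ) + 1, hi⟩ : Fin n)]
    · simp
    · intro j _ hj
      rw [if_neg]
      intro hj'
      exact hj (Fin.ext hj'.symm)
    · simp

/-- A function which is given by a primitive on a measurable set of times and is constant elsewhere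
is integrable; this makes integrability of the right-hand side along a solution automatic. -/
lemma integrableOn_primitive_indicator {h g : ℝ → ℝ} {A : Set ℝ} {c T : ℝ} (hA : MeasurableSet A)
    (hh : IntegrableOn h (Set.Ioc 0 T))
    (hg : ∀ t ∈ Set.Ioc 0 T, g t = c + A.indicator (fun t => ∫ s in (0 : ℝ)..t, h s) t) :
    IntegrableOn g (Set.Ioc 0 T) := by
  rcases lt_or_ge T 0 with hT | hT
  · simp [Set.Ioc_eq_empty (not_lt.2 hT.le)]
  have h1 : ContinuousOn (fun t => ∫ s in (0 : ℝ)..t, h s) (Set.Icc 0 T) := by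
    have := intervalIntegral.continuousOn_primitive_interval (μ := volume) (f := h) (a := 0)
      (b := T) (by rwa [Set.uIcc_of_le hT, integrableOn_Icc_iff_integrableOn_Ioc])
    rwa [Set.uIcc_of_le hT] at this
  have h2 := (h1.integrableOn_Icc (μ := volume)).mono_set Set.Ioc_subset_Icc_self
  have h3 : IntegrableOn (fun t => c + A.indicator (fun t => ∫ s in (0 : ℝ)..t, h s) t)
      (Set.Ioc 0 T) := (integrableOn_const (by simp)).add (h2.indicator hA)
  exact h3.congr_fun (fun t ht => (hg t ht).symm) measurableSet_Ioc

section Solutions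

variable {n : ℕ} {u : ℝ → ℝ} {x : ℝ → Fin n → ℝ}

lemma integral_rhs_apply {t : ℝ}
    (hint : IntervalIntegrable (fun s => (Jmat n) *ᵥ x s + u s • eVec n n) volume 0 t)
    (i : Fin n) :
    (∫ s in (0 : ℝ)..t, ((Jmat n) *ᵥ x s + u s • eVec n n)) i =
      ∫ s in (0 : ℝ)..t, loopField n u x (i + 1) s := by
  have := (ContinuousLinearMap.proj (R := ℝ) (φ := fun _ : Fin n => ℝ) i).intervalIntegral_comp_comm
    hint
  simp only [ContinuousLinearMap.proj_apply, Jmat_mulVec_add_apply] at this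
  exact this.symm

lemma integrableOn_loopField (hu : Measurable u) {C : ℝ}
    (hC : ∀ t, 0 ≤ t → u t ∈ Set.Icc (-C) C)
    (hx : ∀ t, 0 ≤ t → x t = x 0 + ∫ s in (0 : ℝ)..t, ((Jmat n) *ᵥ x s + u s • eVec n n))
    (T : ℝ) (j : ℕ) (h1 : 1 ≤ j) (hj : j ≤ n) :
    IntegrableOn (loopField n u x j) (Set.Ioc 0 T) := by
  induction hk : n - j generalizing j with
  | zero =>
    have hjn : j = n := by omega
    have : loopField n u x j = u := by
      funext s
      simp [loopField, hjn]
    rw [this]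
    refine Measure.integrableOn_of_bounded (M := C) (by simp) hu.aestronglyMeasurable ?_
    rw [ae_restrict_iff' measurableSet_Ioc]
    exact Eventually.of_forall fun s hs => abs_le.2 (hC s hs.1.le)
  | succ k ih =>
    have hj' : j + 1 ≤ n := by omega
    have hrec := ih (j + 1) (by omega) hj' (by omega)
    have hfield : loopField n u x j = fun s => emb n (x s) (j + 1) := by
      funext s
      simp [loopField, show j ≠ n by omega]
    rw [hfield]
    let F : ℝ → Fin n → ℝ := fun s => (Jmat n) *ᵥ x s + u s • eVec n n
    let A : Set ℝ := {t | 0 ≤ t ∧ IntegrableOn F (Set.Ioc 0 t)}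
    have hA : A.OrdConnected := ⟨fun a ha b hb c hc =>
      ⟨ha.1.trans hc.1, hb.2.mono_set (Set.Ioc_subset_Ioc_right hc.2)⟩⟩
    refine integrableOn_primitive_indicator (c := emb n (x 0) (j + 1)) hA.measurableSet hrec
      fun t ht => ?_
    rw [emb_apply _ (by omega) hj', emb_apply _ (by omega) hj', hx t ht.1.le, Pi.add_apply]
    congr 1
    by_cases htA : t ∈ A
    · rw [Set.indicator_of_mem htA, integral_rhs_apply
        ((intervalIntegrable_iff_integrableOn_Ioc_of_le ht.1.le).2 htA.2)]
      rfl
    · rw [Set.indicator_of_notMem htA, intervalIntegral.integral_undef]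
      · rfl
      · rw [intervalIntegrable_iff_integrableOn_Ioc_of_le ht.1.le]
        exact fun h => htA ⟨ht.1.le, h⟩

lemma emb_eq_integral (hu : Measurable u) {C : ℝ}
    (hC : ∀ t, 0 ≤ t → u t ∈ Set.Icc (-C) C)
    (hx : ∀ t, 0 ≤ t → x t = x 0 + ∫ s in (0 : ℝ)..t, ((Jmat n) *ᵥ x s + u s • eVec n n))
    {t : ℝ} (ht : 0 ≤ t) (j : ℕ) (h1 : 1 ≤ j) (hj : j ≤ n) :
    emb n (x t) j = emb n (x 0) j + ∫ s in (0 : ℝ)..t, loopField n u x j s := by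
  have hint : IntervalIntegrable (fun s => (Jmat n) *ᵥ x s + u s • eVec n n) volume 0 t := by
    rw [intervalIntegrable_iff_integrableOn_Ioc_of_le ht]
    refine Integrable.of_eval fun i => ?_
    simp only [Jmat_mulVec_add_apply]
    exact integrableOn_loopField hu hC hx t (i + 1) (by omega) i.2
  rw [emb_apply _ h1 hj, emb_apply _ h1 hj, hx t ht, Pi.add_apply, integral_rhs_apply hint]
  simp only [Nat.sub_add_cancel h1]

lemma continuousOn_emb_apply (hu : Measurable u) {C : ℝ}
    (hC : ∀ t, 0 ≤ t → u t ∈ Set.Icc (-C) C)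
    (hx : ∀ t, 0 ≤ t → x t = x 0 + ∫ s in (0 : ℝ)..t, ((Jmat n) *ᵥ x s + u s • eVec n n))
    (j : ℕ) (h1 : 1 ≤ j) (hj : j ≤ n) :
    ContinuousOn (fun t => emb n (x t) j) (Set.Ici 0) := by
  intro t ht
  have ht : 0 ≤ t := ht
  have h := intervalIntegral.continuousOn_primitive_interval (μ := volume)
    (f := loopField n u x j) (a := 0) (b := t + 1) (by
      rw [Set.uIcc_of_le (by linarith), integrableOn_Icc_iff_integrableOn_Ioc]
      exact integrableOn_loopField hu hC hx (t + 1) j h1 hj)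
  rw [Set.uIcc_of_le (by linarith)] at h
  have h2 : ContinuousOn (fun t => emb n (x t) j) (Set.Icc 0 (t + 1)) :=
    (continuousOn_const.add h).congr fun s hs => emb_eq_integral hu hC hx hs.1 j h1 hj
  refine (h2 t ⟨ht, by linarith⟩).mono_of_mem_nhdsWithin ?_
  rw [← Set.Ici_inter_Iic]
  exact inter_mem self_mem_nhdsWithin (nhdsWithin_le_nhds (Iic_mem_nhds (by linarith)))

lemma continuousOn_solution (hu : Measurable u) {C : ℝ}
    (hC : ∀ t, 0 ≤ t → u t ∈ Set.Icc (-C) C)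
    (hx : ∀ t, 0 ≤ t → x t = x 0 + ∫ s in (0 : ℝ)..t, ((Jmat n) *ᵥ x s + u s • eVec n n)) : ContinuousOn x (Set.Ici 0) := by
  refine continuousOn_pi.2 fun i => ?_
  refine (continuousOn_emb_apply hu hC hx (i + 1) (by omega) i.2).congr fun t _ => ?_
  have h := emb_apply (x t) (show 1 ≤ (i : ℕ) + 1 by omega) i.2
  simpa using h.symm

lemma hasDerivAt_emb_apply (hu : Measurable u) {C : ℝ}
    (hC : ∀ t, 0 ≤ t → u t ∈ Set.Icc (-C) C)
    (hx : ∀ t, 0 ≤ t → x t = x 0 + ∫ s in (0 : ℝ)..t, ((Jmat n) *ᵥ x s + u s • eVec n n))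
    {t : ℝ} (ht : 0 < t) (j : ℕ) (h1 : 1 ≤ j) (hj : j ≤ n)
    (hmeas : StronglyMeasurableAtFilter (loopField n u x j) (nhds t) volume)
    (hcont : ContinuousAt (loopField n u x j) t) :
    HasDerivAt (fun s => emb n (x s) j) (loopField n u x j t) t := by
  have hint : IntervalIntegrable (loopField n u x j) volume 0 t := by
    rw [intervalIntegrable_iff_integrableOn_Ioc_of_le ht.le]
    exact integrableOn_loopField hu hC hx t j h1 hj
  have h := (intervalIntegral.integral_hasDerivAt_right hint hmeas hcont).const_add
    (emb n (x 0) j)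
  refine h.congr_of_eventuallyEq ?_
  filter_upwards [lt_mem_nhds ht] with s hs using emb_eq_integral hu hC hx hs.le j h1 hj

lemma hasDerivAt_emb_of_lt (hu : Measurable u) {C : ℝ}
    (hC : ∀ t, 0 ≤ t → u t ∈ Set.Icc (-C) C)
    (hx : ∀ t, 0 ≤ t → x t = x 0 + ∫ s in (0 : ℝ)..t, ((Jmat n) *ᵥ x s + u s • eVec n n))
    {t : ℝ} (ht : 0 < t) (j : ℕ) (h1 : 1 ≤ j) (hj : j < n) :
    HasDerivAt (fun s => emb n (x s) j) (emb n (x t) (j + 1)) t := by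
  have hfield : loopField n u x j = fun s => emb n (x s) (j + 1) := by
    funext s
    simp [loopField, hj.ne]
  have hc : ContinuousOn (loopField n u x j) (Set.Ioi 0) := by
    rw [hfield]
    exact (continuousOn_emb_apply hu hC hx (j + 1) (by omega) hj).mono Set.Ioi_subset_Ici_self
  have := hasDerivAt_emb_apply hu hC hx ht j h1 hj.le
    (hc.stronglyMeasurableAtFilter isOpen_Ioi t ht) (hc.continuousAt (Ioi_mem_nhds ht))
  rwa [hfield] at this

lemma hasDerivAt_emb_last (hu : Measurable u) {C : ℝ}
    (hC : ∀ t, 0 ≤ t → u t ∈ Set.Icc (-C) C)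
    (hx : ∀ t, 0 ≤ t → x t = x 0 + ∫ s in (0 : ℝ)..t, ((Jmat n) *ᵥ x s + u s • eVec n n))
    {t w : ℝ} (hn : 0 < n) (ht : 0 < t) (hw : ∀ᶠ s in nhds t, u s = w) :
    HasDerivAt (fun s => emb n (x s) n) w t := by
  have hfield : loopField n u x n = u := by
    funext s
    simp [loopField]
  have := hasDerivAt_emb_apply hu hC hx ht n hn le_rfl
    (by rw [hfield]; exact hu.stronglyMeasurable.stronglyMeasurableAtFilter)
    (by rw [hfield]; exact continuousAt_const.congr (hw.mono fun s hs => hs.symm))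
  rwa [hfield, hw.self_of_nhds] at this

lemma isBigO_emb_last (hu : Measurable u) {C : ℝ}
    (hC : ∀ t, 0 ≤ t → u t ∈ Set.Icc (-C) C)
    (hx : ∀ t, 0 ≤ t → x t = x 0 + ∫ s in (0 : ℝ)..t, ((Jmat n) *ᵥ x s + u s • eVec n n))
    {t : ℝ} (hn : 0 < n) (ht : 0 < t) :
    (fun s => emb n (x s) n - emb n (x t) n) =O[nhds t] fun s => s - t := by
  have hfield : loopField n u x n = u := by
    funext s
    simp [loopField]
  have hint : ∀ s, 0 ≤ s → IntervalIntegrable u volume 0 s := fun s hs => by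
    rw [intervalIntegrable_iff_integrableOn_Ioc_of_le hs, ← hfield]
    exact integrableOn_loopField hu hC hx s n hn le_rfl
  refine Asymptotics.IsBigO.of_bound C ?_
  filter_upwards [lt_mem_nhds ht] with s hs
  rw [emb_eq_integral hu hC hx hs.le n hn le_rfl, emb_eq_integral hu hC hx ht.le n hn le_rfl,
    add_sub_add_left_eq_sub, hfield,
    intervalIntegral.integral_interval_sub_left (hint s hs.le) (hint t ht.le)]
  refine intervalIntegral.norm_integral_le_of_norm_le_const fun r hr => ?_
  refine abs_le.2 (hC r ?_)
  exact ((lt_min ht hs).trans hr.1).le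

end Solutions

/-! ### A strict Lyapunov function for the closed loop -/

lemma hasDerivAt_last_of_sign_eventually_eq {n : ℕ} (hn : 0 < n) {l : ℕ → ℝ} {u : ℝ → ℝ}
    {x : ℝ → Fin n → ℝ} (hu : Measurable u) (hC : ∀ t, 0 ≤ t → u t ∈ Set.Icc (-l n) (l n))
    (hx : ∀ t, 0 ≤ t → x t = x 0 + ∫ s in (0 : ℝ)..t, ((Jmat n) *ᵥ x s + u s • eVec n n))
    (hfb : ∀ t, 0 ≤ t → omn n l (x t) ≠ 0 → u t = -l n * Real.sign (omn n l (x t)))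
    {t σ : ℝ} (ht : 0 < t) (hσ : σ ≠ 0) (h : ∀ᶠ s in nhds t, Real.sign (omn n l (x s)) = σ) :
    HasDerivAt (fun s => emb n (x s) n) (-l n * σ) t := by
  refine hasDerivAt_emb_last hu hC hx hn ht ?_
  filter_upwards [h, lt_mem_nhds ht] with s hs hs0
  rw [hfb s hs0.le, hs]
  rwa [Ne, ← Real.sign_eq_zero_iff, hs]

lemma eventually_sign_eq {f : ℝ → ℝ} {t : ℝ} (hf : ContinuousAt f t) (h : f t ≠ 0) :
    ∀ᶠ s in nhds t, Real.sign (f s) = Real.sign (f t) := by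
  rcases h.lt_or_gt with h | h
  · filter_upwards [hf.eventually_lt_const h] with s hs
    rw [Real.sign_of_neg hs, Real.sign_of_neg h]
  · filter_upwards [hf.eventually_const_lt h] with s hs
    rw [Real.sign_of_pos hs, Real.sign_of_pos h]

lemma exists_strict_lyapunov_one :
    ∃ l : ℕ → ℝ, (∀ i, 0 < l i) ∧ ∃ ψ : (Fin 1 → ℝ) → ℝ, Continuous ψ ∧ ψ 0 = 0 ∧
      (∀ v, v ≠ 0 → 0 < ψ v) ∧ ∃ k : ℝ, 0 < k ∧ ∀ x : ℝ → Fin 1 → ℝ, IsFil0 1 l x →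
        ∀ t, 0 < t → x t ≠ 0 → ∃ d, d ≤ -k ∧ HasDerivAt (fun s => ψ (x s)) d t := by
  refine ⟨fun _ => 1, fun _ => one_pos, fun v => |emb 1 v 1|,
    ((continuous_apply 1).comp (continuous_emb 1)).abs, by simp [emb], fun v hv => ?_,
    1, one_pos, fun x hx t ht hxt => ?_⟩
  · obtain ⟨j, h1, h2, h3⟩ := exists_emb_ne_zero hv
    obtain rfl : j = 1 := by omega
    exact abs_pos.2 h3
  · obtain ⟨j, h1, h2, h3⟩ := exists_emb_ne_zero hxt
    obtain rfl : j = 1 := by omega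
    obtain ⟨u, hu, hC, hint, hfb⟩ := hx
    have hom : ∀ v, Real.sign (omn 1 (fun _ => 1) v) = Real.sign (emb 1 v 1) := fun v => by
      have : omn 1 (fun _ => 1) v = Real.sign (emb 1 v 1) := by
        norm_num [omn, omfb, vfb, be, pe, sgnPow]
      rw [this]
      rcases lt_trichotomy (emb 1 v 1) 0 with h | h | h
      · simp [Real.sign_of_neg h, Real.sign_of_neg]
      · simp [h]
      · simp [Real.sign_of_pos h]
    have hcont : ContinuousAt (fun s => emb 1 (x s) 1) t :=
      (continuousOn_emb_apply hu hC hint 1 le_rfl le_rfl).continuousAt (Ici_mem_nhds ht)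
    have hd := hasDerivAt_last_of_sign_eventually_eq one_pos hu hC hint hfb ht
      (σ := Real.sign (emb 1 (x t) 1)) (by rwa [Ne, Real.sign_eq_zero_iff])
      (by simpa only [hom] using eventually_sign_eq hcont h3)
    refine ⟨-1, le_rfl, ?_⟩
    rcases lt_or_gt_of_ne h3 with h | h
    · refine ((hasDerivAt_abs_neg h).comp t hd).congr_deriv ?_
      simp [Real.sign_of_neg h]
    · refine ((hasDerivAt_abs_pos h).comp t hd).congr_deriv ?_
      simp [Real.sign_of_pos h]

lemma exists_strict_lyapunov {n : ℕ} (hn : 0 < n) :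
    ∃ l : ℕ → ℝ, (∀ i, 0 < l i) ∧ ∃ ψ : (Fin n → ℝ) → ℝ, Continuous ψ ∧ ψ 0 = 0 ∧
      (∀ v, v ≠ 0 → 0 < ψ v) ∧ ∃ k : ℝ, 0 < k ∧ ∀ x : ℝ → Fin n → ℝ, IsFil0 n l x →
        ∀ t, 0 < t → x t ≠ 0 → ∃ d, d ≤ -k ∧ HasDerivAt (fun s => ψ (x s)) d t := by
  obtain rfl | hn2 : n = 1 ∨ 2 ≤ n := by omega
  · exact exists_strict_lyapunov_one
  obtain ⟨m, rfl⟩ : ∃ m, n = m + 1 := ⟨n - 1, by omega⟩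
  obtain ⟨l, hl, hrate⟩ := exists_gains_rate_neg hn2 (m + 1) le_rfl
  obtain ⟨k, hk, hdecay⟩ := exists_decay_rate hn2 hrate
  set p : ℝ := ((2 * (m + 1) - 1 : ℕ) : ℝ)⁻¹ with hp_def
  have hp : 0 < p := by
    have : 0 < 2 * (m + 1) - 1 := by omega
    rw [hp_def]
    positivity
  refine ⟨l, hl, fun v => lyap (m + 1) l (m + 1) (emb (m + 1) v) ^ p, ?_, ?_, fun v hv => ?_, k,
    hk, fun x hx t ht hxt => ?_⟩
  · exact ((continuous_lyap hn2 l le_rfl).comp (continuous_emb _)).rpow_const fun _ => Or.inr hp.le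
  · have h0 : lyap (m + 1) l (m + 1) (emb (m + 1) 0) = 0 :=
      lyap_eq_zero hn2 l fun j _ _ => by simp [emb]
    simp only [h0, Real.zero_rpow hp.ne']
  · exact Real.rpow_pos_of_pos (lyap_pos hn2 l (exists_emb_ne_zero hv)) p
  · obtain ⟨u, hu, hC, hint, hfb⟩ := hx
    have hne := exists_emb_ne_zero hxt
    have hcont : ContinuousAt x t :=
      (continuousOn_solution hu hC hint).continuousAt (Ici_mem_nhds ht)
    have hom : Continuous (omn (m + 1) l) :=
      (continuous_omfb hn2 l (Nat.lt_succ_self m)).comp (continuous_emb _)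
    have hd := hasDerivAt_lyap_last (X := fun s => emb (m + 1) (x s)) (t := t) hn2 hl
      (fun j h1 h2 => hasDerivAt_emb_of_lt hu hC hint ht j h1 (by omega))
      (isBigO_emb_last hu hC hint hn ht)
      ((continuousOn_emb_apply hu hC hint (m + 1) hn le_rfl).continuousAt (Ici_mem_nhds ht))
      (fun h0 => hasDerivAt_last_of_sign_eventually_eq hn hu hC hint hfb ht
        (by rwa [Ne, Real.sign_eq_zero_iff])
        (eventually_sign_eq (hom.continuousAt.comp hcont) h0))
    exact ⟨_, hdecay _ hne, hd.rpow_const (Or.inl (lyap_pos hn2 l hne).ne')⟩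

/-- there are positive gains `l_1, …, l_n` such that the discontinuous
feedback `u = -l_n sign(ω_n(x))` stabilizes the `n`-th integrator globally in finite
time, and the origin is Lyapunov stable for the closed loop. -/
theorem nth_integrator_finite_time_stabilization (n : ℕ) (hn : 0 < n) :
    ∃ l : ℕ → ℝ, (∀ i, 0 < l i) ∧
      (∀ x : ℝ → Fin n → ℝ, IsFil0 n l x →
        ∃ T : ℝ, 0 ≤ T ∧ ∀ t, T ≤ t → x t = 0) ∧
      (∀ ε : ℝ, 0 < ε → ∃ δ : ℝ, 0 < δ ∧
        ∀ x : ℝ → Fin n → ℝ, IsFil0 n l x → ‖x 0‖ < δ → ∀ t, 0 ≤ t → ‖x t‖ < ε) := by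
  obtain ⟨l, hl, ψ, hψ, hψ0, hψpos, k, hk, hdec⟩ := exists_strict_lyapunov hn
  have hsol : ∀ x, IsFil0 n l x → ContinuousOn x (Set.Ici 0) := fun x hx => by
    obtain ⟨u, hu, hC, hint, _⟩ := hx
    exact continuousOn_solution hu hC hint
  have hest : ∀ x, IsFil0 n l x → ∀ t, 0 ≤ t → x t ≠ 0 → ψ (x t) ≤ ψ (x 0) - k * t :=
    fun x hx t ht hxt => le_sub_mul_of_pos (φ := fun s => ψ (x s)) hk
      (hψ.comp_continuousOn (hsol x hx))
      (fun s hs hpos => hdec x hx s hs fun h => by simp [h, hψ0] at hpos) ht (hψpos _ hxt)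
  have hnonneg : ∀ v, 0 ≤ ψ v := fun v => by
    by_cases hv : v = 0
    · rw [hv, hψ0]
    · exact (hψpos v hv).le
  refine ⟨l, hl, fun x hx => ⟨ψ (x 0) / k, div_nonneg (hnonneg _) hk.le, fun t ht => ?_⟩,
    fun ε hε => ?_⟩
  · by_contra hxt
    have ht0 : 0 ≤ t := (div_nonneg (hnonneg _) hk.le).trans ht
    have h1 := hest x hx t ht0 hxt
    have h2 := hψpos _ hxt
    rw [div_le_iff₀ hk] at ht
    linarith
  · obtain ⟨δ, hδ, hstab⟩ := exists_stability_radius hψ hψ0 hψpos hε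
    refine ⟨δ, hδ, fun x hx => hstab x (hsol x hx) fun t ht => ?_⟩
    by_cases hxt : x t = 0
    · rw [hxt, hψ0]
      exact hnonneg _
    · have := hest x hx t ht hxt
      nlinarith
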